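/- Suppose k, f, s satisfy (i) k' = k^2 − k·f, (ii) s' = 2·k·s, (iii) f' = f^2 − k·f + 4·s^2 and (iv) k·f = s^2 − c at every point of I, that k(t) ≠ 0 for every t ∈ I, and that the reduced tritension equation −9·k^5 + 19·f·k^4 + (164·s^2 − 9·f^2)·k^3 − 120·s^2·f·k^2 − 32·s^4·k = 0 holds at every point of I. Then a contradiction follows; i.e., no such configuration exists. (This is the analytic core of the theorem that every triharmonic Riemannian submersion from a 3-dimensional space form M^3(c) onto a surface is harmonic.) -/

import Mathlib

/-- The triharmonicity polynomial in the ratios `x = f / k`, `y = σ² / k²` and its first two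
derivatives along the reduced flow have no common zero. -/
lemma tritension_no_common_zero (x y : ℝ)
    (hp : -9 + 19 * x + 164 * y - 9 * x ^ 2 - 120 * x * y - 32 * y ^ 2 = 0)
    (hq :
      202 * y - 304 * y ^ 2 - 19 * x + 128 * x * y - 64 * x * y ^ 2 + 37 * x ^ 2
        - 240 * x ^ 2 * y - 18 * x ^ 3 = 0)
    (hr :
      164 * y - 352 * y ^ 2 - 128 * y ^ 3 + 19 * x + 350 * x * y - 1632 * x * y ^ 2
        - 93 * x ^ 2 + 388 * x ^ 2 * y - 192 * x ^ 2 * y ^ 2 + 128 * x ^ 3 - 720 * x ^ 3 * y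
        - 54 * x ^ 4 = 0) :
    False := by
  have h : (450916147393719210 : ℝ) = 0 := by
    linear_combination
      (-50101794154857690 - 12660869423484934694 * y + 16064053752918461144 * y ^ 2
          + 4216689296600958144 * y ^ 3 + 2090748775054438766 * x - 5478389950422972334 * x * y
          - 5668274617932730048 * x * y ^ 2 - 2560688999833193678 * x ^ 2
          + 16918553546495700960 * x ^ 2 * y - 2108344648300479072 * x ^ 2 * y ^ 2
          + 970958166327331812 * x ^ 3) * hp +
      (-755098341011831385 + 10300549449787704220 * y + 1779964984816125488 * y ^ 2
          + 298405144239070700 * x - 8633807099793519558 * x * y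
          + 4216689296600958144 * x * y ^ 2) * hq +
      (285358136063549931 + 58176775515223026 * y - 1054172324150239536 * y ^ 2
          - 161826361054555302 * x) * hr
  norm_num at h

lemma HasDerivAt.eq_zero_of_eqOn_zero {U : Set ℝ} (hU : IsOpen U) {g : ℝ → ℝ} {g' t : ℝ}
    (ht : t ∈ U) (hg : HasDerivAt g g' t) (h0 : ∀ u ∈ U, g u = 0) : g' = 0 :=
  hg.unique <| (hasDerivAt_const t (0 : ℝ)).congr_of_eventuallyEq <|
    Filter.eventuallyEq_of_mem (hU.mem_nhds ht) h0

/-- Analytic core of the triharmonicity ⇒ harmonicity theorem for Riemannian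
submersions from 3-dimensional space forms: along an integral curve of `e₁`,
the structure equations of the integrability data `k = k₁`, `f = f₂`, `s = σ`
of the submersion together with `k ≠ 0` and the reduced tritension equation
lead to a contradiction. -/
theorem triharmonic_submersion_core_contradiction
    (a b : ℝ) (hab : a < b) (I : Set ℝ) (hI : I = Set.Ioo a b)
    (k f s : ℝ → ℝ) (hk : ContDiff ℝ (⊤ : ℕ∞) k) (hf : ContDiff ℝ (⊤ : ℕ∞) f)
    (hs : ContDiff ℝ (⊤ : ℕ∞) s) (c : ℝ)
    (h1 : ∀ t ∈ I, deriv k t = k t ^ 2 - k t * f t)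
    (h2 : ∀ t ∈ I, deriv s t = 2 * k t * s t)
    (h3 : ∀ t ∈ I, deriv f t = f t ^ 2 - k t * f t + 4 * s t ^ 2)
    (h4 : ∀ t ∈ I, k t * f t = s t ^ 2 - c)
    (hk0 : ∀ t ∈ I, k t ≠ 0)
    (htri : ∀ t ∈ I,
      -9 * k t ^ 5 + 19 * f t * k t ^ 4 + (164 * s t ^ 2 - 9 * f t ^ 2) * k t ^ 3
        - 120 * s t ^ 2 * f t * k t ^ 2 - 32 * s t ^ 4 * k t = 0) :
    False := by
  have hopen : IsOpen I := hI ▸ isOpen_Ioo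
  have hdk : ∀ t ∈ I, HasDerivAt k (k t ^ 2 - k t * f t) t := fun t ht =>
    h1 t ht ▸ (hk.differentiable (by simp) t).hasDerivAt
  have hds : ∀ t ∈ I, HasDerivAt s (2 * k t * s t) t := fun t ht =>
    h2 t ht ▸ (hs.differentiable (by simp) t).hasDerivAt
  have hdf : ∀ t ∈ I, HasDerivAt f (f t ^ 2 - k t * f t + 4 * s t ^ 2) t := fun t ht =>
    h3 t ht ▸ (hf.differentiable (by simp) t).hasDerivAt
  obtain ⟨x, hx⟩ : ∃ x : ℝ → ℝ, x = fun t => f t / k t := ⟨_, rfl⟩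
  obtain ⟨y, hy⟩ : ∃ y : ℝ → ℝ, y = fun t => s t ^ 2 / k t ^ 2 := ⟨_, rfl⟩
  have hdx : ∀ t ∈ I, HasDerivAt x (2 * k t * (x t ^ 2 - x t + 2 * y t)) t := by
    intro t ht
    have hkt := hk0 t ht
    rw [hx, hy]
    refine ((hdf t ht).fun_div (hdk t ht) hkt).congr_deriv ?_
    field_simp
    ring
  have hdy : ∀ t ∈ I, HasDerivAt y (2 * k t * (y t + x t * y t)) t := by
    intro t ht
    have hkt := hk0 t ht
    rw [hx, hy]
    refine (((hds t ht).fun_pow 2).fun_div ((hdk t ht).fun_pow 2)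
      (pow_ne_zero 2 hkt)).congr_deriv ?_
    field_simp
    ring
  have hp : ∀ t ∈ I,
      -9 + 19 * x t + 164 * y t - 9 * x t ^ 2 - 120 * x t * y t - 32 * y t ^ 2 = 0 := by
    intro t ht
    have hkt := hk0 t ht
    refine (mul_eq_zero.mp ?_).resolve_left (pow_ne_zero 5 hkt)
    rw [← htri t ht, hx, hy]
    field_simp
    ring
  have hq : ∀ t ∈ I,
      202 * y t - 304 * y t ^ 2 - 19 * x t + 128 * x t * y t - 64 * x t * y t ^ 2
        + 37 * x t ^ 2 - 240 * x t ^ 2 * y t - 18 * x t ^ 3 = 0 := by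
    intro t ht
    have hX := hdx t ht
    have hY := hdy t ht
    have hd := HasDerivAt.eq_zero_of_eqOn_zero hopen ht
      ((((((hX.const_mul 19).const_add (-9)).fun_add (hY.const_mul 164)).fun_sub
        ((hX.fun_pow 2).const_mul 9)).fun_sub ((hX.const_mul 120).fun_mul hY)).fun_sub
        ((hY.fun_pow 2).const_mul 32)) hp
    refine (mul_eq_zero.mp ?_).resolve_left (mul_ne_zero two_ne_zero (hk0 t ht))
    rw [← hd]
    push_cast
    ring
  have hr : ∀ t ∈ I,
      164 * y t - 352 * y t ^ 2 - 128 * y t ^ 3 + 19 * x t + 350 * x t * y t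
        - 1632 * x t * y t ^ 2 - 93 * x t ^ 2 + 388 * x t ^ 2 * y t - 192 * x t ^ 2 * y t ^ 2
        + 128 * x t ^ 3 - 720 * x t ^ 3 * y t - 54 * x t ^ 4 = 0 := by
    intro t ht
    have hX := hdx t ht
    have hY := hdy t ht
    have hd := HasDerivAt.eq_zero_of_eqOn_zero hopen ht
      ((((((((hY.const_mul 202).fun_sub ((hY.fun_pow 2).const_mul 304)).fun_sub
        (hX.const_mul 19)).fun_add ((hX.const_mul 128).fun_mul hY)).fun_sub
        ((hX.const_mul 64).fun_mul (hY.fun_pow 2))).fun_add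
        ((hX.fun_pow 2).const_mul 37)).fun_sub
        (((hX.fun_pow 2).const_mul 240).fun_mul hY)).fun_sub
        ((hX.fun_pow 3).const_mul 18)) hq
    refine (mul_eq_zero.mp ?_).resolve_left (mul_ne_zero two_ne_zero (hk0 t ht))
    rw [← hd]
    push_cast
    ring
  obtain ⟨t, ht⟩ : I.Nonempty := hI ▸ Set.nonempty_Ioo.mpr hab
  exact tritension_no_common_zero (x t) (y t) (hp t ht) (hq t ht) (hr t ht)
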